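/- Let Γ be a distance-regular graph with classical parameters (D, b, α, β) such that b ≥ 2 and D ≥ 3, and assume Γ is geometric with respect to a set 𝓒 of Delsarte cliques. Then for every clique C ∈ 𝓒 and every vertex x at distance j from C (0 ≤ j ≤ D−1), the number of vertices of C at distance j from x equals 1 + α[j]; and for every pair of vertices x, y at distance j (1 ≤ j ≤ D), the number of cliques in 𝓒 containing x and at distance j−1 from y equals [j]. -/

import Mathlib

open SimpleGraph

namespace DRGPaper

variable {V : Type*}

/-- `Γ` is a distance-regular graph with diameter `D` and intersection arrays `cc`, `aa`, `bb`:
`Γ` is connected of diameter `D` and for any vertices `x, y` at distance `i ≤ D`, `y` has exactly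
`cc i` neighbours at distance `i - 1` from `x`, `aa i` neighbours at distance `i` from `x`,
and `bb i` neighbours at distance `i + 1` from `x`. -/
def IsDRG [Fintype V] (G : SimpleGraph V) (D : ℕ) (cc aa bb : ℕ → ℕ) : Prop :=
  G.Connected ∧
  (∀ x y : V, G.dist x y ≤ D) ∧
  (∃ x y : V, G.dist x y = D) ∧
  ∀ i : ℕ, i ≤ D → ∀ x y : V, G.dist x y = i →
    {z : V | G.Adj y z ∧ G.dist x z = i - 1}.ncard = cc i ∧
    {z : V | G.Adj y z ∧ G.dist x z = i}.ncard = aa i ∧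
    {z : V | G.Adj y z ∧ G.dist x z = i + 1}.ncard = bb i

/-- `[j] = (b^j - 1)/(b - 1) = 1 + b + ⋯ + b^(j-1)` as a real number. -/
def gauss (b j : ℕ) : ℝ := ∑ i ∈ Finset.range j, (b : ℝ) ^ i

/-- `Γ` has classical parameters `(D, b, α, β)`: it is distance-regular of diameter `D` with
`bb i = ([D] - [i])(β - α[i])` for `0 ≤ i ≤ D - 1` and `cc i = [i](1 + α[i-1])` for
`1 ≤ i ≤ D`. -/
def HasClassicalParams [Fintype V] (G : SimpleGraph V) (D b : ℕ) (α β : ℝ)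
    (cc aa bb : ℕ → ℕ) : Prop :=
  IsDRG G D cc aa bb ∧
  (∀ i : ℕ, i ≤ D - 1 → (bb i : ℝ) = (gauss b D - gauss b i) * (β - α * gauss b i)) ∧
  (∀ i : ℕ, 1 ≤ i → i ≤ D → (cc i : ℝ) = gauss b i * (1 + α * gauss b (i - 1)))

/-- `d(x, C) = min {d(x, y) : y ∈ C}`. -/
noncomputable def distToSet (G : SimpleGraph V) (x : V) (C : Set V) : ℕ :=
  sInf (G.dist x '' C)

/-- A maximal clique of `G`. -/
def IsMaxClique (G : SimpleGraph V) (s : Set V) : Prop :=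
  G.IsClique s ∧ ∀ t : Set V, G.IsClique t → s ⊆ t → t = s

/-- The lines for the PLS(γ) property: maximal cliques with at least `γ` vertices. -/
def plsLines (G : SimpleGraph V) (γ : ℕ) : Set (Set V) :=
  {ℓ : Set V | IsMaxClique G ℓ ∧ γ ≤ ℓ.ncard}

/-- `G` is the point graph of the partial linear space with line set `L`: any two adjacent
vertices lie on exactly one common line of `L`. -/
def IsPointGraphOf (G : SimpleGraph V) (L : Set (Set V)) : Prop :=
  ∀ x y : V, G.Adj x y → ∃! ℓ : Set V, ℓ ∈ L ∧ x ∈ ℓ ∧ y ∈ ℓ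

/-- A vertex is a Delsarte vertex (w.r.t. the line set `L` and classical parameter `β`) if all
lines through it have exactly `β + 1` vertices. -/
def IsDelsarteVertex (L : Set (Set V)) (β : ℝ) (x : V) : Prop :=
  ∀ ℓ ∈ L, x ∈ ℓ → (ℓ.ncard : ℝ) = β + 1

/-- The lines for the SPLS(c, s) property: maximal cliques with at least
`a1 + 2 - (c - 1)(s - 1)` vertices. -/
def splsLines (G : SimpleGraph V) (a1 c s : ℕ) : Set (Set V) :=
  {ℓ : Set V | IsMaxClique G ℓ ∧ (a1 : ℤ) + 2 - ((c : ℤ) - 1) * ((s : ℤ) - 1) ≤ (ℓ.ncard : ℤ)}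

/-- The SPLS(c, s) property: `G` is the point graph of the partial linear space whose lines are
the maximal cliques with at least `a1 + 2 - (c-1)(s-1)` vertices, `a1 ≥ (2s-1)(c-1)`, each
vertex lies on at most `s` lines, and every point not on a line `ℓ` is collinear with at most
`c` points of `ℓ`.  SPLS(s) is the case `c = c₂`. -/
def HasSPLS (G : SimpleGraph V) (a1 c s : ℕ) : Prop :=
  1 ≤ c ∧ 2 ≤ s ∧
  (2 * (s : ℤ) - 1) * ((c : ℤ) - 1) ≤ (a1 : ℤ) ∧
  IsPointGraphOf G (splsLines G a1 c s) ∧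
  (∀ x : V, {ℓ ∈ splsLines G a1 c s | x ∈ ℓ}.ncard ≤ s) ∧
  (∀ ℓ ∈ splsLines G a1 c s, ∀ x : V, x ∉ ℓ → {y ∈ ℓ | G.Adj x y}.ncard ≤ c)

/-- `[x, y]`: the set of lines `ℓ ∈ L` through `x` such that `d(y, u) ≤ 2` for all `u ∈ ℓ`. -/
def lineXY (G : SimpleGraph V) (L : Set (Set V)) (x y : V) : Set (Set V) :=
  {ℓ ∈ L | x ∈ ℓ ∧ ∀ u ∈ ℓ, G.dist y u ≤ 2}

/-- `𝓒` witnesses that `G` is geometric with cliques of order `q`: every member of `𝓒` is a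
clique with exactly `q` vertices and every edge of `G` lies in a unique member of `𝓒`. -/
def IsGeomLineSet (G : SimpleGraph V) (q : ℝ) (𝓒 : Set (Set V)) : Prop :=
  (∀ C ∈ 𝓒, G.IsClique C ∧ (C.ncard : ℝ) = q) ∧
  ∀ x y : V, G.Adj x y → ∃! C : Set V, C ∈ 𝓒 ∧ x ∈ C ∧ y ∈ C

/-- `G` is geometric: there is a set of Delsarte cliques (cliques of the maximum order `q`)
such that every edge lies in a unique member. -/
def IsGeometric (G : SimpleGraph V) (q : ℝ) : Prop :=
  ∃ 𝓒 : Set (Set V), IsGeomLineSet G q 𝓒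

/-- An assembly: a maximal clique which is not a line. -/
def IsAssembly (G : SimpleGraph V) (𝓒 : Set (Set V)) (M : Set V) : Prop :=
  IsMaxClique G M ∧ M ∉ 𝓒

/-- The dual Pasch axiom: for every pair of adjacent vertices `x, y`, the common neighbours of
`x` and `y` outside the (any) line of `𝓒` through `x` and `y` form a clique. -/
def DualPasch (G : SimpleGraph V) (𝓒 : Set (Set V)) : Prop :=
  ∀ x y : V, G.Adj x y → ∀ ℓ ∈ 𝓒, x ∈ ℓ → y ∈ ℓ →
    G.IsClique {z : V | G.Adj x z ∧ G.Adj y z ∧ z ∉ ℓ}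

/-- The `m × n` grid, i.e. the Cartesian product `K_m □ K_n`. -/
def gridGraph (m n : ℕ) : SimpleGraph (Fin m × Fin n) :=
  (⊤ : SimpleGraph (Fin m)).boxProd (⊤ : SimpleGraph (Fin n))

/-- The `A`-clique extension of a graph `H`: replace every vertex of `H` by a clique of size
`A`, vertices in distinct cliques being adjacent exactly when the underlying vertices of `H`
are adjacent. -/
def cliqueExt {W : Type*} (H : SimpleGraph W) (A : ℕ) : SimpleGraph (W × Fin A) :=
  SimpleGraph.fromRel (fun p q => H.Adj p.1 q.1 ∨ p.1 = q.1)

/-- `θ` is an eigenvalue of the adjacency matrix of `G`. -/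
def IsAdjEigenvalue [Fintype V] (G : SimpleGraph V) [DecidableRel G.Adj] (θ : ℝ) : Prop :=
  ∃ v : V → ℝ, v ≠ 0 ∧ (G.adjMatrix ℝ).mulVec v = θ • v

lemma exists_adj_dist_eq {G : SimpleGraph V} (hG : G.Connected) {x y : V} {n : ℕ}
    (hxy : G.dist x y = n + 1) : ∃ z, G.Adj y z ∧ G.dist x z = n := by
  obtain ⟨p, hp⟩ := hG.exists_walk_length_eq_dist y x
  rw [dist_comm, hxy] at hp
  cases p with
  | nil => simp at hp
  | @cons _ z _ hyz q =>
    refine ⟨z, hyz, ?_⟩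
    have hzx := dist_le q
    have htri := hG.dist_triangle (u := x) (v := z) (w := y)
    rw [dist_eq_one_iff_adj.2 hyz.symm] at htri
    rw [dist_comm] at hzx
    simp only [Walk.length_cons] at hp
    omega

lemma exists_dist_eq_of_le {G : SimpleGraph V} (hG : G.Connected) {x y : V} {n m : ℕ}
    (hxy : G.dist x y = n) (hmn : m ≤ n) : ∃ z, G.dist x z = m := by
  induction n generalizing y with
  | zero => exact ⟨y, by omega⟩
  | succ n ih =>
    rcases hmn.eq_or_lt with rfl | hlt
    · exact ⟨y, hxy⟩
    · obtain ⟨z, -, hz⟩ := exists_adj_dist_eq hG hxy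
      exact ih hz (by omega)

lemma dist_le_dist_add_one {G : SimpleGraph V} (hG : G.Connected) (x : V) {y z : V}
    (hyz : G.Adj y z) : G.dist x z ≤ G.dist x y + 1 := by
  have htri := hG.dist_triangle (u := x) (v := y) (w := z)
  rwa [dist_eq_one_iff_adj.2 hyz] at htri

lemma IsDRG.cc_pos [Fintype V] {G : SimpleGraph V} {D : ℕ} {cc aa bb : ℕ → ℕ}
    (hG : IsDRG G D cc aa bb) {i : ℕ} (hi : i < D) : 0 < cc (i + 1) := by
  obtain ⟨hconn, -, ⟨x, y, hxy⟩, hcount⟩ := hG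
  obtain ⟨z, hz⟩ := exists_dist_eq_of_le hconn hxy (Nat.succ_le_of_lt hi)
  obtain ⟨w, hzw, hw⟩ := exists_adj_dist_eq hconn hz
  rw [← (hcount (i + 1) hi x z hz).1, Set.ncard_pos]
  exact ⟨w, hzw, by simpa using hw⟩

lemma IsDRG.bb_pos [Fintype V] {G : SimpleGraph V} {D : ℕ} {cc aa bb : ℕ → ℕ}
    (hG : IsDRG G D cc aa bb) {i : ℕ} (hi : i < D) : 0 < bb i := by
  obtain ⟨hconn, -, ⟨x, y, hxy⟩, hcount⟩ := hG
  obtain ⟨z, hz⟩ := exists_dist_eq_of_le hconn hxy (Nat.succ_le_of_lt hi)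
  obtain ⟨w, hzw, hw⟩ := exists_adj_dist_eq hconn hz
  rw [← (hcount i hi.le x w hw).2.2, Set.ncard_pos]
  exact ⟨z, hzw.symm, hz⟩

lemma gauss_lt_gauss {b : ℕ} (hb : 0 < b) {i j : ℕ} (hij : i < j) : gauss b i < gauss b j :=
  Finset.sum_lt_sum_of_subset (Finset.range_mono hij.le) (Finset.mem_range.2 hij)
    (by simp) (by positivity) (fun _ _ _ => by positivity)

lemma gauss_zero (b : ℕ) : gauss b 0 = 0 := by simp [gauss]

section ClassicalParams

variable [Fintype V] {G : SimpleGraph V} {D b : ℕ} {α β : ℝ} {cc aa bb : ℕ → ℕ}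

lemma HasClassicalParams.one_add_ne_zero (h : HasClassicalParams G D b α β cc aa bb) {i : ℕ}
    (hi : i < D) : 1 + α * gauss b i ≠ 0 := by
  have hc := h.2.2 (i + 1) (by omega) hi
  have hpos : (0 : ℝ) < cc (i + 1) := mod_cast h.1.cc_pos hi
  rw [hc, Nat.add_sub_cancel] at hpos
  exact right_ne_zero_of_mul hpos.ne'

lemma HasClassicalParams.sub_pos (h : HasClassicalParams G D b α β cc aa bb) (hb : 0 < b)
    {i : ℕ} (hi : i < D) : 0 < β - α * gauss b i := by
  have hpos : (0 : ℝ) < bb i := mod_cast h.1.bb_pos hi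
  rw [h.2.1 i (by omega)] at hpos
  exact pos_of_mul_pos_right hpos (by linarith [gauss_lt_gauss hb hi])

lemma HasClassicalParams.beta_pos (h : HasClassicalParams G D b α β cc aa bb) (hb : 0 < b)
    (hD : 0 < D) : 0 < β := by
  simpa [gauss_zero] using h.sub_pos hb hD

lemma HasClassicalParams.bb_eq (h : HasClassicalParams G D b α β cc aa bb) {i : ℕ} (hi : i ≤ D) :
    (bb i : ℝ) = (gauss b D - gauss b i) * (β - α * gauss b i) := by
  rcases hi.eq_or_lt with rfl | hlt
  · obtain ⟨-, hdiam, ⟨x, y, hxy⟩, hcount⟩ := h.1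
    rw [← (hcount i le_rfl x y hxy).2.2]
    have hempty : {z : V | G.Adj y z ∧ G.dist x z = i + 1} = ∅ := by
      ext z
      have := hdiam x z
      simp only [Set.mem_ofPred_eq, Set.mem_empty_iff_false, iff_false]
      omega
    simp [hempty]
  · exact h.2.1 i (by omega)

open Classical in
lemma IsDRG.card_adj (hG : IsDRG G D cc aa bb) (y : V) :
    (Finset.univ.filter (G.Adj y)).card = bb 0 := by
  rw [← (hG.2.2.2 0 (Nat.zero_le _) y y dist_self).2.2, Set.ncard_eq_toFinset_card']
  congr 1
  ext z
  simp

open Classical in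
/-- The action of the adjacency operator on a function of the distance to a fixed vertex. -/
lemma IsDRG.sum_adj (hG : IsDRG G D cc aa bb) (u : ℕ → ℝ) {x y : V} {i : ℕ}
    (hxy : G.dist x y = i) :
    ∑ z with G.Adj y z, u (G.dist x z) =
      bb 0 * u i + bb i * (u (i + 1) - u i) + cc i * (u (i - 1) - u i) := by
  have hi : i ≤ D := hxy ▸ hG.2.1 x y
  obtain ⟨hc, -, hbi⟩ := hG.2.2.2 i hi x y hxy
  have hsplit : ∀ z ∈ Finset.univ.filter (G.Adj y), u (G.dist x z) =
      u i + (if G.dist x z = i + 1 then u (i + 1) - u i else 0) +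
        (if G.dist x z = i - 1 then u (i - 1) - u i else 0) := by
    intro z hz
    have hyz : G.Adj y z := by simpa using hz
    have h₁ := dist_le_dist_add_one hG.1 x hyz
    have h₂ := dist_le_dist_add_one hG.1 x hyz.symm
    rw [hxy] at h₁ h₂
    obtain hd | hd | ⟨hd, hne⟩ : G.dist x z = i + 1 ∨ G.dist x z = i ∨
        (G.dist x z = i - 1 ∧ i ≠ 0) := by omega
    · have : i + 1 ≠ i - 1 := by omega
      simp [hd, this]
    · rcases eq_or_ne i 0 with rfl | hne
      · simp [hd]
      · have : i ≠ i - 1 := by omega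
        simp [hd, this]
    · have : i - 1 ≠ i + 1 := by omega
      simp [hd, this]
  rw [Finset.sum_congr rfl hsplit, Finset.sum_add_distrib, Finset.sum_add_distrib,
    ← Finset.sum_filter, ← Finset.sum_filter, Finset.filter_filter, Finset.filter_filter]
  simp only [Finset.sum_const, nsmul_eq_mul, hG.card_adj y]
  rw [← hc, ← hbi, Set.ncard_eq_toFinset_card', Set.ncard_eq_toFinset_card',
    Set.toFinset_ofPred, Set.toFinset_ofPred]

/-- The standard sequence of the eigenvalue `-[D]`. -/
noncomputable def stdSeq (b : ℕ) (α β : ℝ) (i : ℕ) : ℝ :=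
  ∏ j ∈ Finset.range i, (-(1 + α * gauss b j) / (β - α * gauss b j))

lemma HasClassicalParams.stdSeq_ne_zero (h : HasClassicalParams G D b α β cc aa bb) (hb : 0 < b)
    {i : ℕ} (hi : i ≤ D) : stdSeq b α β i ≠ 0 := by
  refine Finset.prod_ne_zero_iff.2 fun j hj => ?_
  have hj' : j < D := (Finset.mem_range.1 hj).trans_le hi
  exact div_ne_zero (neg_ne_zero.2 (h.one_add_ne_zero hj')) (h.sub_pos hb hj').ne'

lemma HasClassicalParams.sub_mul_stdSeq_succ (h : HasClassicalParams G D b α β cc aa bb)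
    (hb : 0 < b) {i : ℕ} (hi : i < D) :
    (β - α * gauss b i) * stdSeq b α β (i + 1) = -(1 + α * gauss b i) * stdSeq b α β i := by
  have := (h.sub_pos hb hi).ne'
  rw [stdSeq, Finset.prod_range_succ, ← stdSeq]
  field_simp

open Classical in
/-- The standard sequence gives eigenvectors of the adjacency operator for `-[D]`. -/
lemma HasClassicalParams.sum_adj_stdSeq (h : HasClassicalParams G D b α β cc aa bb) (hb : 0 < b)
    (x y : V) :
    ∑ z with G.Adj y z, stdSeq b α β (G.dist x z) =
      -gauss b D * stdSeq b α β (G.dist x y) := by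
  rw [h.1.sum_adj (stdSeq b α β) rfl]
  have hi := h.1.2.1 x y
  generalize G.dist x y = i at hi
  have hk := h.bb_eq (Nat.zero_le D)
  rw [gauss_zero] at hk
  have hup : (bb i : ℝ) * stdSeq b α β (i + 1) =
      -(gauss b D - gauss b i) * (1 + α * gauss b i) * stdSeq b α β i := by
    rw [h.bb_eq hi]
    rcases hi.eq_or_lt with rfl | hlt
    · simp
    · linear_combination (gauss b D - gauss b i) * h.sub_mul_stdSeq_succ hb hlt
  have hdown : (cc i : ℝ) * (stdSeq b α β (i - 1) - stdSeq b α β i) =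
      -gauss b i * (β + 1) * stdSeq b α β i := by
    cases i with
    | zero => simp [gauss_zero]
    | succ i =>
      have hc := h.2.2 (i + 1) (by omega) hi
      rw [Nat.add_sub_cancel] at hc ⊢
      rw [hc]
      linear_combination gauss b (i + 1) * h.sub_mul_stdSeq_succ hb hi
  rw [hdown, mul_sub, hup, hk, h.bb_eq hi]
  ring

end ClassicalParams

section Geometric

variable [Fintype V] {G : SimpleGraph V} {q : ℝ} {𝓒 : Set (Set V)}

open Classical in
/-- The neighbours of a vertex are partitioned by the lines through it. -/
lemma IsGeomLineSet.sum_lines (hgeo : IsGeomLineSet G q 𝓒) (y : V) (g : V → ℝ) :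
    ∑ C : Set V with C ∈ 𝓒 ∧ y ∈ C, ∑ z with z ∈ C ∧ z ≠ y, g z =
      ∑ z with G.Adj y z, g z := by
  rw [Finset.sum_comm' (t' := Finset.univ.filter (G.Adj y))
    (s' := fun z => Finset.univ.filter fun C : Set V => C ∈ 𝓒 ∧ y ∈ C ∧ z ∈ C)]
  · refine Finset.sum_congr rfl fun z hz => ?_
    obtain ⟨C, hC, huniq⟩ := hgeo.2 y z (by simpa using hz)
    have hsingle : Finset.univ.filter (fun C : Set V => C ∈ 𝓒 ∧ y ∈ C ∧ z ∈ C) = {C} := by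
      ext C'
      simp only [Finset.mem_filter, Finset.mem_univ, true_and, Finset.mem_singleton]
      exact ⟨huniq C', fun heq => heq ▸ hC⟩
    rw [hsingle, Finset.sum_singleton]
  · intro C z
    simp only [Finset.mem_filter, Finset.mem_univ, true_and]
    constructor
    · rintro ⟨⟨hC, hy⟩, hz, hne⟩
      exact ⟨⟨hC, hy, hz⟩, (hgeo.1 C hC).1 hy hz hne.symm⟩
    · rintro ⟨⟨hC, hy, hz⟩, hadj⟩
      exact ⟨⟨hC, hy⟩, hz, hadj.ne'⟩

open Classical in
lemma sum_mem_eq_add {C : Set V} {y : V} (hy : y ∈ C) (g : V → ℝ) :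
    ∑ z with z ∈ C, g z = g y + ∑ z with z ∈ C ∧ z ≠ y, g z := by
  rw [← Finset.add_sum_erase _ _ (show y ∈ Finset.univ.filter (· ∈ C) by simpa using hy)]
  congr 2
  ext z
  simp [and_comm]

open Classical in
lemma card_filter_mem (C : Set V) : (Finset.univ.filter (· ∈ C)).card = C.ncard := by
  rw [Set.ncard_eq_toFinset_card']
  congr 1
  ext z
  simp

open Classical in
/-- Counting the neighbours of a vertex along the lines through it. -/
lemma IsGeomLineSet.card_lines_mul (hgeo : IsGeomLineSet G q 𝓒) (y : V) :
    ((Finset.univ.filter fun C : Set V => C ∈ 𝓒 ∧ y ∈ C).card : ℝ) * (q - 1) =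
      (Finset.univ.filter (G.Adj y)).card := by
  have hsum := hgeo.sum_lines y (fun _ => 1)
  have hconst : ∀ C ∈ Finset.univ.filter (fun C : Set V => C ∈ 𝓒 ∧ y ∈ C),
      ∑ z with z ∈ C ∧ z ≠ y, (1 : ℝ) = q - 1 := by
    intro C hC
    obtain ⟨hC, hy⟩ : C ∈ 𝓒 ∧ y ∈ C := by simpa using hC
    have hadd := sum_mem_eq_add hy (fun _ => 1)
    rw [Finset.sum_const, nsmul_one, card_filter_mem, (hgeo.1 C hC).2] at hadd
    linarith
  rw [Finset.sum_congr rfl hconst] at hsum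
  rw [Finset.sum_const, nsmul_eq_mul, Finset.sum_const, nsmul_one] at hsum
  exact hsum

open Classical in
/-- If every vertex lies on `s` lines, an eigenvector of the adjacency operator for `-s` sums to
zero on every line. -/
lemma IsGeomLineSet.sum_eq_zero (hgeo : IsGeomLineSet G q 𝓒) {s : ℝ} {f : V → ℝ}
    (hs : ∀ y, ((Finset.univ.filter fun C : Set V => C ∈ 𝓒 ∧ y ∈ C).card : ℝ) = s)
    (hf : ∀ y, ∑ z with G.Adj y z, f z = -s * f y) {C : Set V} (hC : C ∈ 𝓒) :
    ∑ z with z ∈ C, f z = 0 := by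
  have hlines : ∀ y, ∑ C : Set V with C ∈ 𝓒 ∧ y ∈ C, ∑ z with z ∈ C, f z = 0 := by
    intro y
    have hadd : ∀ C ∈ Finset.univ.filter (fun C : Set V => C ∈ 𝓒 ∧ y ∈ C),
        ∑ z with z ∈ C, f z = f y + ∑ z with z ∈ C ∧ z ≠ y, f z := by
      intro C hC
      exact sum_mem_eq_add (by simp at hC; exact hC.2) f
    rw [Finset.sum_congr rfl hadd, Finset.sum_add_distrib, hgeo.sum_lines, hf,
      Finset.sum_const, nsmul_eq_mul, hs]
    ring
  have hsq : ∑ C : Set V with C ∈ 𝓒, (∑ z with z ∈ C, f z) ^ 2 = 0 := by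
    simp only [sq]
    calc ∑ C : Set V with C ∈ 𝓒, (∑ y with y ∈ C, f y) * ∑ z with z ∈ C, f z
        = ∑ C : Set V with C ∈ 𝓒, ∑ y with y ∈ C, f y * ∑ z with z ∈ C, f z := by
          simp only [Finset.sum_mul]
      _ = ∑ y, ∑ C : Set V with C ∈ 𝓒 ∧ y ∈ C, f y * ∑ z with z ∈ C, f z :=
          Finset.sum_comm' (by simp)
      _ = 0 := by simp only [← Finset.mul_sum, hlines, mul_zero, Finset.sum_const_zero]
  rw [Finset.sum_eq_zero_iff_of_nonneg fun _ _ => sq_nonneg _] at hsq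
  exact pow_eq_zero_iff two_ne_zero |>.1 (hsq C (by simpa using hC))

end Geometric

lemma distToSet_le (G : SimpleGraph V) (x : V) {C : Set V} {y : V} (hy : y ∈ C) :
    distToSet G x C ≤ G.dist x y :=
  Nat.sInf_le ⟨y, hy, rfl⟩

lemma exists_dist_eq_distToSet (G : SimpleGraph V) (x : V) {C : Set V} (hC : C.Nonempty) :
    ∃ y ∈ C, G.dist x y = distToSet G x C :=
  Nat.sInf_mem (hC.image _)

lemma dist_le_distToSet_add_one {G : SimpleGraph V} (hG : G.Connected) (x : V) {C : Set V}
    (hC : G.IsClique C) {y : V} (hy : y ∈ C) : G.dist x y ≤ distToSet G x C + 1 := by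
  obtain ⟨z, hz, hxz⟩ := exists_dist_eq_distToSet G x ⟨y, hy⟩
  rcases eq_or_ne z y with rfl | hne
  · omega
  · exact hxz ▸ dist_le_dist_add_one hG x (hC hz hy hne)

section Counting

variable [Fintype V] {G : SimpleGraph V} {D b : ℕ} {α β : ℝ} {cc aa bb : ℕ → ℕ}
  {𝓒 : Set (Set V)}

open Classical in
lemma HasClassicalParams.card_lines (h : HasClassicalParams G D b α β cc aa bb) (hb : 0 < b)
    (hD : 0 < D) (hgeo : IsGeomLineSet G (β + 1) 𝓒) (y : V) :
    ((Finset.univ.filter fun C : Set V => C ∈ 𝓒 ∧ y ∈ C).card : ℝ) = gauss b D := by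
  have hmul := hgeo.card_lines_mul y
  rw [h.1.card_adj y, h.bb_eq (Nat.zero_le D), gauss_zero] at hmul
  refine mul_right_cancel₀ (h.beta_pos hb hD).ne' ?_
  linear_combination hmul

/-- A vertex at distance `j < D` from a line sees `1 + α[j]` of its vertices at distance `j`. -/
lemma HasClassicalParams.ncard_nearest (h : HasClassicalParams G D b α β cc aa bb) (hb : 0 < b)
    (hgeo : IsGeomLineSet G (β + 1) 𝓒) {C : Set V} (hC : C ∈ 𝓒) {j : ℕ} (hj : j < D) {x : V}
    (hx : distToSet G x C = j) :
    ({y ∈ C | G.dist x y = j}.ncard : ℝ) = 1 + α * gauss b j := by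
  classical
  have hsum : ∑ y with y ∈ C, stdSeq b α β (G.dist x y) = 0 :=
    hgeo.sum_eq_zero (h.card_lines hb (by omega) hgeo) (h.sum_adj_stdSeq hb x) hC
  have hsplit : ∀ y ∈ Finset.univ.filter (· ∈ C), stdSeq b α β (G.dist x y) =
      stdSeq b α β (j + 1) +
        if G.dist x y = j then stdSeq b α β j - stdSeq b α β (j + 1) else 0 := by
    intro y hy
    have hy : y ∈ C := by simpa using hy
    have hle := dist_le_distToSet_add_one h.1.1 x (hgeo.1 C hC).1 hy
    have hge := distToSet_le G x hy
    rw [hx] at hle hge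
    obtain hd | hd : G.dist x y = j ∨ G.dist x y = j + 1 := by omega
    all_goals simp [hd]
  have hcard : (Finset.univ.filter fun y => y ∈ C ∧ G.dist x y = j).card =
      {y ∈ C | G.dist x y = j}.ncard := by
    rw [← card_filter_mem]
    simp
  rw [Finset.sum_congr rfl hsplit, Finset.sum_add_distrib, ← Finset.sum_filter,
    Finset.filter_filter, Finset.sum_const, Finset.sum_const, card_filter_mem, hcard,
    nsmul_eq_mul, nsmul_eq_mul, (hgeo.1 C hC).2] at hsum
  have hβ := h.beta_pos hb (by omega)
  refine mul_right_cancel₀ (mul_ne_zero (by positivity : β + 1 ≠ 0)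
    (h.stdSeq_ne_zero hb hj.le)) ?_
  linear_combination (β - α * gauss b j) * hsum -
    (β + 1 - {y ∈ C | G.dist x y = j}.ncard) * h.sub_mul_stdSeq_succ hb hj

/-- For vertices at distance `j + 1`, exactly `[j + 1]` lines through one are at distance `j` from
the other. -/
lemma HasClassicalParams.ncard_lines_nearest (h : HasClassicalParams G D b α β cc aa bb)
    (hb : 0 < b) (hgeo : IsGeomLineSet G (β + 1) 𝓒) {x y : V} {j : ℕ} (hj : j < D)
    (hxy : G.dist x y = j + 1) :
    ({C ∈ 𝓒 | x ∈ C ∧ distToSet G y C = j}.ncard : ℝ) = gauss b (j + 1) := by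
  classical
  rw [dist_comm] at hxy
  have hsum := hgeo.sum_lines x (fun z => if G.dist y z = j then 1 else 0)
  have hinner : ∀ C ∈ Finset.univ.filter (fun C : Set V => C ∈ 𝓒 ∧ x ∈ C),
      (∑ z with z ∈ C ∧ z ≠ x, if G.dist y z = j then (1 : ℝ) else 0) =
        if distToSet G y C = j then 1 + α * gauss b j else 0 := by
    intro C hC
    obtain ⟨hC, hx⟩ : C ∈ 𝓒 ∧ x ∈ C := by simpa using hC
    have hadd := sum_mem_eq_add hx (fun z => if G.dist y z = j then (1 : ℝ) else 0)
    rw [if_neg (by omega), zero_add] at hadd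
    rw [← hadd]
    split_ifs with hd
    · rw [← h.ncard_nearest hb hgeo hC hj hd, ← card_filter_mem, ← Finset.sum_filter,
        Finset.filter_filter]
      simp
    · refine Finset.sum_eq_zero fun z hz => if_neg fun hzj => hd ?_
      have hz : z ∈ C := by simpa using hz
      have hle := dist_le_distToSet_add_one h.1.1 y (hgeo.1 C hC).1 hx
      have hge := distToSet_le G y hz
      omega
  have hc := h.2.2 (j + 1) (by omega) hj
  rw [Nat.add_sub_cancel] at hc
  rw [Finset.sum_congr rfl hinner, ← Finset.sum_filter, ← Finset.sum_filter,
    Finset.filter_filter, Finset.filter_filter, Finset.sum_const, Finset.sum_const,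
    nsmul_eq_mul, nsmul_one] at hsum
  have hlines : (Finset.univ.filter fun C : Set V => (C ∈ 𝓒 ∧ x ∈ C) ∧ distToSet G y C = j).card =
      {C ∈ 𝓒 | x ∈ C ∧ distToSet G y C = j}.ncard := by
    rw [← card_filter_mem]
    simp only [Set.mem_ofPred_eq, and_assoc]
  have hnbrs : (Finset.univ.filter fun z => G.Adj x z ∧ G.dist y z = j).card = cc (j + 1) := by
    rw [← (h.1.2.2.2 (j + 1) hj y x hxy).1, ← card_filter_mem]
    simp
  rw [hlines, hnbrs, hc] at hsum
  exact mul_right_cancel₀ (h.one_add_ne_zero hj) hsum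

end Counting

/-- for a geometric distance-regular graph with classical parameters
`(D, b, α, β)`, `b ≥ 2`, `D ≥ 3`: a vertex at distance `j ≤ D - 1` from a Delsarte clique
`C ∈ 𝓒` sees exactly `1 + α[j]` vertices of `C` at distance `j`; and for vertices `x, y` at
distance `j` (`1 ≤ j ≤ D`) there are exactly `[j]` cliques of `𝓒` containing `x` at distance
`j - 1` from `y`. -/
theorem statement_10 {V : Type*} [Fintype V] (G : SimpleGraph V) (D b : ℕ) (α β : ℝ)
    (cc aa bb : ℕ → ℕ) (hb : 2 ≤ b) (hD : 3 ≤ D)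
    (h : HasClassicalParams G D b α β cc aa bb)
    (𝓒 : Set (Set V)) (hgeo : IsGeomLineSet G (β + 1) 𝓒) :
    (∀ C ∈ 𝓒, ∀ j : ℕ, j ≤ D - 1 → ∀ x : V, distToSet G x C = j →
      ({y ∈ C | G.dist x y = j}.ncard : ℝ) = 1 + α * gauss b j) ∧
    (∀ x y : V, ∀ j : ℕ, 1 ≤ j → j ≤ D → G.dist x y = j →
      ({C ∈ 𝓒 | x ∈ C ∧ distToSet G y C = j - 1}.ncard : ℝ) = gauss b j) := by
  refine ⟨fun C hC j hj x hx => h.ncard_nearest (by omega) hgeo hC (by omega) hx,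
    fun x y j hj hjD hxy => ?_⟩
  obtain ⟨i, rfl⟩ := Nat.exists_eq_add_of_le' hj
  exact h.ncard_lines_nearest (by omega) hgeo hjD hxy

end DRGPaper
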